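/- Let n ≥ 8 or n = 3, and let M be a special real n×n matrix. Then g_M(n) ≥ 2(n−1)!. -/

import Mathlib

open Finset

/-- A real n×n matrix (rows/columns indexed by `Fin n`, with index 0 playing the role
of "1") is special if it is non-zero, its first row and first column are zero, and all
its row sums are zero. -/
def IsSpecial (n : ℕ) [NeZero n] (M : Matrix (Fin n) (Fin n) ℝ) : Prop :=
  M ≠ 0 ∧ (∀ i, M i 0 = 0) ∧ (∀ j, M 0 j = 0) ∧ (∀ i, ∑ j, M i j = 0)

open scoped Classical in
/-- g_M(X): the number of permutations π in X whose associated diagonal sum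
∑ i, m_{i,π(i)} is nonzero. -/
noncomputable def gM (n : ℕ) (M : Matrix (Fin n) (Fin n) ℝ)
    (X : Finset (Equiv.Perm (Fin n))) : ℕ :=
  (X.filter (fun π => ∑ i, M i (π i) ≠ 0)).card

/-- g_M(n): the number of permutations π in Sym_n with ∑ i, m_{i,π(i)} ≠ 0. -/
noncomputable def gMn (n : ℕ) (M : Matrix (Fin n) (Fin n) ℝ) : ℕ :=
  gM n M Finset.univ

open Equiv

section PermutationCounts

variable {n : ℕ}

lemma card_perm_apply_pair {a b j k : Fin n} (hab : a ≠ b) (hjk : j ≠ k) :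
    #{π : Perm (Fin n) | π a = j ∧ π b = k} = (n - 2).factorial := by
  have hle : ∀ j k j' k' : Fin n, j ≠ k → j' ≠ k' →
      #{π : Perm (Fin n) | π a = j ∧ π b = k} ≤ #{π : Perm (Fin n) | π a = j' ∧ π b = k'} := by
    intro j k j' k' h h'
    have h1 : swap j j' k ≠ j' := by
      intro e
      exact h ((swap j j').injective (by rw [swap_apply_left, e]))
    apply card_le_card_of_injOn (fun π => swap (swap j j' k) k' * swap j j' * π)
    · intro π hπ
      simp only [coe_filter, mem_univ, true_and, Set.mem_ofPred_eq] at hπ ⊢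
      simp only [Perm.mul_apply, hπ.1, hπ.2, swap_apply_left, and_true]
      exact swap_apply_of_ne_of_ne h1.symm h'
    · intro π _ ρ _ e
      exact mul_left_cancel e
  have hsum : n.factorial = ∑ x ∈ (univ : Finset (Fin n)).offDiag,
      #{π ∈ (univ : Finset (Perm (Fin n))) | (π a, π b) = x} := by
    rw [← card_eq_sum_card_fiberwise]
    · rw [card_univ, Fintype.card_perm, Fintype.card_fin]
    · intro π _
      simpa using hab
  have hconst : ∀ x ∈ (univ : Finset (Fin n)).offDiag,
      #{π ∈ (univ : Finset (Perm (Fin n))) | (π a, π b) = x}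
        = #{π : Perm (Fin n) | π a = j ∧ π b = k} := by
    rintro ⟨j', k'⟩ hx
    have hx' : j' ≠ k' := by simpa using hx
    simp only [Prod.mk.injEq]
    exact le_antisymm (hle _ _ _ _ hx' hjk) (hle _ _ _ _ hjk hx')
  rw [sum_congr rfl hconst, sum_const, offDiag_card, card_univ, Fintype.card_fin,
    smul_eq_mul] at hsum
  have h2 : 2 ≤ n := by
    have := Fin.val_ne_of_ne hab
    omega
  obtain ⟨m, rfl⟩ := Nat.exists_eq_add_of_le' h2
  have e : (m + 2) * (m + 2) - (m + 2) = (m + 2) * (m + 1) := by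
    rw [Nat.sub_eq_iff_eq_add (by nlinarith)]; ring
  rw [e, Nat.factorial_succ, Nat.factorial_succ, ← mul_assoc] at hsum
  exact (Nat.eq_of_mul_eq_mul_left (by positivity) hsum).symm

lemma card_perm_rel {a b : Fin n} (hab : a ≠ b) (R : Fin n → Fin n → Prop)
    [∀ j k, Decidable (R j k)] :
    #{π : Perm (Fin n) | R (π a) (π b)}
      = (∑ j, #{k | j ≠ k ∧ R j k}) * (n - 2).factorial := by
  have hpairs : ∑ j, #{k | j ≠ k ∧ R j k}
      = #{x : Fin n × Fin n | x.1 ≠ x.2 ∧ R x.1 x.2} := by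
    simp only [card_filter]
    rw [← univ_product_univ, sum_product]
  rw [hpairs, card_eq_sum_card_fiberwise (f := fun π : Perm (Fin n) => (π a, π b))
    (t := {x : Fin n × Fin n | x.1 ≠ x.2 ∧ R x.1 x.2})]
  · rw [← smul_eq_mul, ← sum_const]
    refine sum_congr rfl ?_
    rintro ⟨j, k⟩ hx
    simp only [mem_filter, mem_univ, true_and] at hx
    rw [← card_perm_apply_pair hab hx.1, filter_filter]
    congr 1
    ext π
    simp only [mem_filter, mem_univ, true_and, Prod.mk.injEq]
    constructor
    · exact fun h => h.2
    · rintro ⟨rfl, rfl⟩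
      exact ⟨hx.2, rfl, rfl⟩
  · intro π hπ
    simp only [coe_filter, mem_univ, true_and, Set.mem_ofPred_eq] at hπ ⊢
    exact ⟨fun e => hab (π.injective e), hπ⟩

lemma card_perm_inv_rel {a b : Fin n} (hab : a ≠ b) (R : Fin n → Fin n → Prop)
    [∀ j k, Decidable (R j k)] :
    #{π : Perm (Fin n) | R (π⁻¹ a) (π⁻¹ b)}
      = (∑ j, #{k | j ≠ k ∧ R j k}) * (n - 2).factorial := by
  rw [← card_perm_rel hab R]
  apply card_bij (fun π _ => π⁻¹)
  · intro π hπ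
    simpa using hπ
  · intro π _ ρ _ e
    exact inv_injective e
  · intro π hπ
    refine ⟨π⁻¹, ?_, inv_inv π⟩
    simp only [mem_filter, mem_univ, true_and, inv_inv] at hπ ⊢
    exact hπ

lemma factorial_pred_eq (hn : 2 ≤ n) :
    (n - 1).factorial = (n - 1) * (n - 2).factorial := by
  obtain ⟨m, rfl⟩ := Nat.exists_eq_add_of_le' hn
  exact Nat.factorial_succ m

lemma card_perm_apply {a r : Fin n} (hn : 2 ≤ n) :
    #{π : Perm (Fin n) | π a = r} = (n - 1).factorial := by
  have : Nontrivial (Fin n) := Fin.nontrivial_iff_two_le.mpr hn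
  obtain ⟨b, hb⟩ := exists_ne a
  rw [card_perm_rel hb.symm (fun j _ => j = r), factorial_pred_eq hn]
  congr 1
  rw [sum_eq_single r]
  · simp only [and_true]
    rw [filter_ne univ r, card_erase_of_mem (mem_univ _), card_univ, Fintype.card_fin]
  · intro j _ hj
    simp [hj]
  · simp

lemma card_le_two_mul_card_filter_ne_zero {G : Type*} [Group G] (S : Finset G) (f : G → ℝ)
    (t : G) [DecidablePred fun g => f g ≠ 0] (hS : ∀ g ∈ S, g * t ∈ S)
    (hf : ∀ g ∈ S, f g = 0 → f (g * t) ≠ 0) :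
    #S ≤ 2 * #{g ∈ S | f g ≠ 0} := by
  classical
  have h := card_filter_add_card_filter_not (s := S) (fun g => f g ≠ 0)
  have h' : #{g ∈ S | ¬ f g ≠ 0} ≤ #{g ∈ S | f g ≠ 0} := by
    apply card_le_card_of_injOn (fun g => g * t)
    · intro g hg
      simp only [coe_filter, Set.mem_ofPred_eq, not_not] at hg ⊢
      exact ⟨hS g hg.1, hf g hg.1 hg.2⟩
    · intro g _ g' _ e
      exact mul_right_cancel e
  omega

end PermutationCounts

section RowCounts

variable {n : ℕ}

lemma card_mul_add_card_mul_le_sum (T : Finset (Fin n)) (g : Fin n → ℕ) (x y : ℕ)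
    (hx : ∀ j ∈ T, x ≤ g j) (hy : ∀ j ∉ T, y ≤ g j) :
    #T * x + (n - #T) * y ≤ ∑ j, g j := by
  rw [← sum_add_sum_compl T g]
  have hc : #Tᶜ = n - #T := by rw [card_compl, Fintype.card_fin]
  rw [← hc]
  exact add_le_add (card_nsmul_le_sum T g x hx)
    (card_nsmul_le_sum Tᶜ g y fun j hj => hy j (mem_compl.mp hj))

lemma card_filter_eq_add_card_filter_ne (r : Fin n → ℝ) (w : ℝ) :
    #{i | r i = w} + #{i | r i ≠ w} = n := by
  have := card_filter_add_card_filter_not (s := (univ : Finset (Fin n))) (fun i => r i = w)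
  simpa using this

lemma card_filter_ne_and_ne (r : Fin n → ℝ) (j : Fin n) :
    #{k | j ≠ k ∧ r j ≠ r k} = #{k | r k ≠ r j} := by
  congr 1
  ext k
  simp only [mem_filter, mem_univ, true_and]
  exact ⟨fun h => h.2.symm, fun h => ⟨fun e => h (by rw [e]), h.symm⟩⟩

lemma two_mul_card_mul_card_le_sum (r : Fin n → ℝ) (w : ℝ) :
    2 * (#{i | r i = w} * #{i | r i ≠ w}) ≤ ∑ j, #{k | j ≠ k ∧ r j ≠ r k} := by
  have hc := card_filter_eq_add_card_filter_ne r w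
  have := card_mul_add_card_mul_le_sum {i | r i = w} (fun j => #{k | j ≠ k ∧ r j ≠ r k})
    #{i | r i ≠ w} #{i | r i = w} ?_ ?_
  · have e : n - #{i | r i = w} = #{i | r i ≠ w} := by omega
    rw [e] at this
    linarith [mul_comm (#{i | r i = w}) (#{i | r i ≠ w})]
  · intro j hj
    simp only [mem_filter, mem_univ, true_and] at hj
    rw [card_filter_ne_and_ne, hj]
  · intro j hj
    simp only [mem_filter, mem_univ, true_and] at hj
    rw [card_filter_ne_and_ne]
    apply card_le_card
    intro k hk
    simp only [mem_filter, mem_univ, true_and] at hk ⊢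
    rw [hk]
    exact Ne.symm hj

lemma sum_card_ne_of_three_le (hn : 8 ≤ n) (r : Fin n → ℝ) (h : ∀ w, 3 ≤ #{i | r i ≠ w}) :
    4 * (n - 1) ≤ ∑ j, #{k | j ≠ k ∧ r j ≠ r k} := by
  by_cases hw : ∃ w, 3 ≤ #{i | r i = w}
  · obtain ⟨w, hw⟩ := hw
    refine le_trans ?_ (two_mul_card_mul_card_le_sum r w)
    have hc := card_filter_eq_add_card_filter_ne r w
    have h3 := h w
    generalize #{i | r i = w} = s at *
    generalize #{i | r i ≠ w} = t at *
    obtain ⟨s, rfl⟩ := Nat.exists_eq_add_of_le hw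
    obtain ⟨t, rfl⟩ := Nat.exists_eq_add_of_le h3
    have : 4 * (n - 1) = 4 * (s + t) + 20 := by omega
    rw [this]
    nlinarith [Nat.zero_le (s * t)]
  · push Not at hw
    have := card_mul_add_card_mul_le_sum univ (fun j => #{k | j ≠ k ∧ r j ≠ r k})
      (n - 2) 0 ?_ (by simp)
    · rw [card_univ, Fintype.card_fin] at this
      refine le_trans ?_ this
      obtain ⟨m, rfl⟩ := Nat.exists_eq_add_of_le hn
      have e1 : 8 + m - 1 = 7 + m := by omega
      have e2 : 8 + m - 2 = 6 + m := by omega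
      rw [e1, e2]
      nlinarith
    · intro j _
      rw [card_filter_ne_and_ne]
      have := hw (r j)
      have hc := card_filter_eq_add_card_filter_ne r (r j)
      omega

lemma sum_eq_sum_filter_ne (r : Fin n → ℝ) (w : ℝ) :
    ∑ i, r i = ∑ i with r i ≠ w, (r i - w) + n * w := by
  have h1 : ∑ i with r i ≠ w, (r i - w) = ∑ i, (r i - w) := by
    apply sum_subset (subset_univ _)
    intro i _ hi
    simp only [mem_filter, mem_univ, true_and, not_not] at hi
    rw [hi, sub_self]
  rw [h1, sum_sub_distrib]
  simp

lemma exists_pair_of_card_ne_le_two [NeZero n] (hn : 3 ≤ n) (r : Fin n → ℝ) (h0 : r 0 = 0)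
    (hsum : ∑ j, r j = 0) (hr : ∃ j, r j ≠ 0) (w : ℝ) (hw : #{i | r i ≠ w} ≤ 2) :
    ∃ p q, p ≠ q ∧ r p ≠ w ∧ r q ≠ w ∧ r p ≠ r q ∧ ∀ j, j ≠ p → j ≠ q → r j = w := by
  have hs := sum_eq_sum_filter_ne r w
  rw [hsum] at hs
  have hn' : (3 : ℝ) ≤ n := by exact_mod_cast hn
  have hmem : ∀ i, i ∈ ({i | r i ≠ w} : Finset (Fin n)) ↔ r i ≠ w := by simp
  obtain h | h | h : #{i | r i ≠ w} = 0 ∨ #{i | r i ≠ w} = 1 ∨ #{i | r i ≠ w} = 2 := by omega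
  · rw [card_eq_zero] at h
    simp only [h, notMem_empty, false_iff, not_not] at hmem
    obtain ⟨j, hj⟩ := hr
    exact absurd (by rw [hmem j, ← hmem 0, h0]) hj
  · obtain ⟨p, hp⟩ := card_eq_one.mp h
    rw [hp, sum_singleton] at hs
    simp only [hp, mem_singleton] at hmem
    have hpw : r p ≠ w := (hmem p).mp rfl
    by_cases h0w : r 0 = w
    · rw [h0] at h0w
      rw [← h0w] at hs hpw
      exact absurd (by linarith) hpw
    · have e := (hmem 0).mpr h0w
      rw [← e, h0] at hs hpw
      have : ((n : ℝ) - 1) * w = 0 := by linarith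
      rcases mul_eq_zero.mp this with h | h
      · linarith
      · exact absurd h.symm hpw
  · obtain ⟨p, q, hpq, hD⟩ := card_eq_two.mp h
    rw [hD, sum_pair hpq] at hs
    simp only [hD, mem_insert, mem_singleton] at hmem
    have hpw : r p ≠ w := (hmem p).mp (Or.inl rfl)
    have hqw : r q ≠ w := (hmem q).mp (Or.inr rfl)
    refine ⟨p, q, hpq, hpw, hqw, ?_, ?_⟩
    · intro e
      rw [← e] at hs
      by_cases h0w : r 0 = w
      · rw [h0] at h0w
        rw [← h0w] at hs hpw
        exact hpw (by linarith)
      · have hp0 : r p = 0 := by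
          rcases (hmem 0).mpr h0w with e' | e'
          · rw [← e', h0]
          · rw [e, ← e', h0]
        rw [hp0] at hs hpw
        have : ((n : ℝ) - 2) * w = 0 := by linarith
        rcases mul_eq_zero.mp this with h | h
        · linarith
        · exact hpw h.symm
    · intro j hjp hjq
      by_contra hj
      rcases (hmem j).mpr hj with e | e
      · exact hjp e
      · exact hjq e

lemma sum_card_ne_of_pair (hn : 3 ≤ n) (r : Fin n → ℝ) (w : ℝ) {p q : Fin n} (hpq : p ≠ q)
    (hp : r p ≠ w) (hq : r q ≠ w) (hrpq : r p ≠ r q)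
    (h : ∀ j, j ≠ p → j ≠ q → r j = w) :
    4 * n - 6 ≤ ∑ j, #{k | j ≠ k ∧ r j ≠ r k} := by
  have := card_mul_add_card_mul_le_sum {p, q} (fun j => #{k | j ≠ k ∧ r j ≠ r k})
    (n - 1) 2 ?_ ?_
  · rw [card_pair hpq] at this
    omega
  · intro j hj
    have : ({k | j ≠ k ∧ r j ≠ r k} : Finset (Fin n)) = univ.erase j := by
      ext k
      simp only [mem_filter, mem_univ, true_and, mem_erase, and_true]
      refine ⟨fun h => h.1.symm, fun hk => ⟨hk.symm, ?_⟩⟩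
      simp only [mem_insert, mem_singleton] at hj
      grind
    rw [this, card_erase_of_mem (mem_univ _), card_univ, Fintype.card_fin]
  · intro j hj
    simp only [mem_insert, mem_singleton, not_or] at hj
    rw [← card_pair hpq]
    apply card_le_card
    intro k hk
    simp only [mem_insert, mem_singleton] at hk
    simp only [mem_filter, mem_univ, true_and]
    grind

lemma two_mul_le_sum_card_ne_affine (hn : 8 ≤ n) (a : Fin n → ℝ) (ha : ∀ w, ∃ i, a i ≠ w) :
    2 * (n - 1) ≤ ∑ k, #{i | k ≠ i ∧ ∑ l, a l ≠ a i + (n - 1) * a k} := by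
  have hn' : (8 : ℝ) ≤ n := by exact_mod_cast hn
  have hall : (∀ k, 2 ≤ #{i | k ≠ i ∧ ∑ l, a l ≠ a i + (n - 1) * a k}) →
      2 * (n - 1) ≤ ∑ k, #{i | k ≠ i ∧ ∑ l, a l ≠ a i + (n - 1) * a k} := by
    intro h
    have := card_mul_add_card_mul_le_sum univ
      (fun k => #{i | k ≠ i ∧ ∑ l, a l ≠ a i + (n - 1) * a k}) 2 0 (fun k _ => h k) (by simp)
    rw [card_univ, Fintype.card_fin] at this
    omega
  have hsub : ∀ (k : Fin n) (D : Finset (Fin n)),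
      (∀ i ∈ D, ∑ l, a l ≠ a i + (n - 1) * a k) →
      D.erase k ⊆ ({i | k ≠ i ∧ ∑ l, a l ≠ a i + (n - 1) * a k} : Finset (Fin n)) := by
    intro k D hD i hi
    simp only [mem_filter, mem_univ, true_and]
    exact ⟨(ne_of_mem_erase hi).symm, hD i (mem_of_mem_erase hi)⟩
  by_cases h : ∀ w, 3 ≤ #{i | a i ≠ w}
  · apply hall
    intro k
    have h1 := card_le_card (hsub k {i | a i ≠ ∑ l, a l - (n - 1) * a k} (by
      intro i hi e
      simp only [mem_filter, mem_univ, true_and] at hi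
      exact hi (by linarith)))
    have h2 := pred_card_le_card_erase (s := {i | a i ≠ ∑ l, a l - (n - 1) * a k}) (a := k)
    have h3 := h (∑ l, a l - (n - 1) * a k)
    omega
  · push Not at h
    obtain ⟨w, hw⟩ := h
    have hmem : ∀ i, i ∈ ({i | a i ≠ w} : Finset (Fin n)) ↔ a i ≠ w := by simp
    have hs := sum_eq_sum_filter_ne a w
    obtain h | h | h : #{i | a i ≠ w} = 0 ∨ #{i | a i ≠ w} = 1 ∨ #{i | a i ≠ w} = 2 := by omega
    · rw [card_eq_zero] at h
      obtain ⟨i, hi⟩ := ha w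
      have := (hmem i).mpr hi
      simp [h] at this
    · obtain ⟨d, hd⟩ := card_eq_one.mp h
      rw [hd, sum_singleton] at hs
      simp only [hd, mem_singleton] at hmem
      have hdw : a d ≠ w := (hmem d).mp rfl
      have hoff : ∀ i, i ≠ d → a i = w := fun i hi => by
        by_contra h'
        exact hi ((hmem i).mpr h')
      apply hall
      intro k
      have h1 := card_le_card (hsub k (univ.erase d) (by
        intro i hi e
        rw [hoff i (ne_of_mem_erase hi)] at e
        by_cases hk : k = d
        · rw [hk] at e
          have : ((n : ℝ) - 2) * (w - a d) = 0 := by linarith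
          rcases mul_eq_zero.mp this with h' | h'
          · linarith
          · exact hdw (by linarith)
        · rw [hoff k hk] at e
          exact hdw (by linarith)))
      have h2 := pred_card_le_card_erase (s := univ.erase d) (a := k)
      rw [card_erase_of_mem (mem_univ _), card_univ, Fintype.card_fin] at h2
      omega
    · have hc := card_filter_eq_add_card_filter_ne a w
      have key : ∀ k, #(({i | a i ≠ w} : Finset (Fin n)).erase k)
          ≤ #{i | k ≠ i ∧ ∑ l, a l ≠ a i + (n - 1) * a k} ∨
          2 ≤ #{i | k ≠ i ∧ ∑ l, a l ≠ a i + (n - 1) * a k} := by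
        intro k
        by_cases hk : ∑ l, a l - (n - 1) * a k = w
        · left
          apply card_le_card (hsub k _ _)
          intro i hi e
          exact (hmem i).mp hi (by linarith)
        · right
          have h1 := card_le_card (hsub k {i | a i = w} (by
            intro i hi e
            simp only [mem_filter, mem_univ, true_and] at hi
            exact hk (by linarith)))
          have h2 := pred_card_le_card_erase (s := {i | a i = w}) (a := k)
          omega
      have := card_mul_add_card_mul_le_sum {i | a i ≠ w}
        (fun k => #{i | k ≠ i ∧ ∑ l, a l ≠ a i + (n - 1) * a k}) 1 2 ?_ ?_
      · rw [h] at this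
        omega
      · intro k hk
        have := key k
        rw [card_erase_of_mem hk] at this
        omega
      · intro k hk
        have := key k
        rw [erase_eq_of_notMem hk] at this
        omega

end RowCounts

section DiagonalSums

variable {n : ℕ}

lemma gMn_eq_card [NeZero n] (M : Matrix (Fin n) (Fin n) ℝ) :
    gMn n M = #{π : Perm (Fin n) | ∑ i, M i (π i) ≠ 0} := by
  unfold gMn gM
  congr

lemma sum_mul_swap_zero [NeZero n] (M : Matrix (Fin n) (Fin n) ℝ) (h0 : ∀ j, M 0 j = 0)
    (b : Fin n) (π : Perm (Fin n)) :
    ∑ i, M i ((π * swap 0 b) i) = ∑ i, M i (π i) + (M b (π 0) - M b (π b)) := by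
  rw [← sub_eq_iff_eq_add', ← sum_sub_distrib, sum_eq_single b]
  · simp
  · intro i _ hi
    by_cases hi0 : i = 0
    · simp [hi0, h0]
    · rw [Perm.mul_apply, swap_apply_of_ne_of_ne hi0 hi, sub_self]
  · simp

lemma sum_eq_of_const_off_pair (M : Matrix (Fin n) (Fin n) ℝ) {p q : Fin n} (hpq : p ≠ q)
    (a : Fin n → ℝ) (ha : ∀ i j, j ≠ p → j ≠ q → M i j = a i) (π : Perm (Fin n)) :
    ∑ i, M i (π i) = ∑ i, a i + (M (π⁻¹ p) p - a (π⁻¹ p)) + (M (π⁻¹ q) q - a (π⁻¹ q)) := by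
  have h : ∀ i, M i (π i) = a i + (if π⁻¹ p = i then M i p - a i else 0)
      + (if π⁻¹ q = i then M i q - a i else 0) := by
    intro i
    simp only [Perm.inv_eq_iff_eq]
    by_cases h1 : p = π i
    · have h2 : q ≠ π i := fun e => hpq (h1.trans e.symm)
      simp only [if_pos h1, if_neg h2]
      rw [← h1]
      ring
    · by_cases h2 : q = π i
      · simp only [if_neg h1, if_pos h2]
        rw [← h2]
        ring
      · simp only [if_neg h1, if_neg h2]
        rw [ha i _ (Ne.symm h1) (Ne.symm h2)]
        ring
  simp only [h, sum_add_distrib, sum_ite_eq, mem_univ, if_true]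

lemma row_sum_of_const_off_pair (r : Fin n → ℝ) {p q : Fin n} (hpq : p ≠ q) (a : ℝ)
    (ha : ∀ j, j ≠ p → j ≠ q → r j = a) :
    ∑ j, r j = n * a + (r p - a) + (r q - a) := by
  have h : ∀ j, r j = a + (if p = j then r p - a else 0) + (if q = j then r q - a else 0) := by
    intro j
    by_cases h1 : p = j
    · have h2 : q ≠ j := fun e => hpq (h1.trans e.symm)
      simp only [if_pos h1, if_neg h2]
      rw [h1]
      ring
    · by_cases h2 : q = j
      · simp only [if_neg h1, if_pos h2]
        rw [h2]
        ring
      · simp only [if_neg h1, if_neg h2]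
        rw [ha j (Ne.symm h1) (Ne.symm h2)]
        ring
  rw [sum_congr rfl fun j _ => h j]
  simp only [sum_add_distrib, sum_ite_eq, mem_univ, if_true, sum_const, card_univ,
    Fintype.card_fin, nsmul_eq_mul]

lemma le_gMn_of_zero_off_pair [NeZero n] (hn : 2 ≤ n) (M : Matrix (Fin n) (Fin n) ℝ)
    (hM : IsSpecial n M) {p q : Fin n} (hpq : p ≠ q)
    (ha : ∀ i j, j ≠ p → j ≠ q → M i j = 0) :
    2 * (n - 1).factorial ≤ gMn n M := by
  obtain ⟨hne, -, hrow, hsum⟩ := hM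
  have hq : ∀ i, M i q = - M i p := by
    intro i
    have h := row_sum_of_const_off_pair (M i) hpq 0 (ha i)
    rw [hsum i] at h
    linarith
  have hdiag : ∀ π : Perm (Fin n), (∑ i, M i (π i) ≠ 0) ↔ M (π⁻¹ p) p ≠ M (π⁻¹ q) p := by
    intro π
    rw [sum_eq_of_const_off_pair M hpq (fun _ => 0) ha π, hq]
    simp only [sum_const_zero, zero_add, sub_zero, ne_eq]
    rw [add_neg_eq_zero]
  rw [gMn_eq_card]
  simp only [hdiag]
  rw [card_perm_inv_rel hpq (fun i k => M i p ≠ M k p), factorial_pred_eq hn, ← mul_assoc]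
  apply Nat.mul_le_mul_right
  refine le_trans ?_ (two_mul_card_mul_card_le_sum (fun i => M i p) 0)
  have hc := card_filter_eq_add_card_filter_ne (fun i => M i p) 0
  have h1 : 0 < #{i | M i p = 0} := card_pos.mpr ⟨0, by simp [hrow]⟩
  have h2 : 0 < #{i | M i p ≠ 0} := by
    rw [card_pos]
    by_contra hemp
    rw [not_nonempty_iff_eq_empty, filter_eq_empty_iff] at hemp
    simp only [mem_univ, true_imp_iff, not_not] at hemp
    apply hne
    ext i j
    by_cases hjp : j = p
    · rw [hjp, @hemp i]; rfl
    · by_cases hjq : j = q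
      · rw [hjq, hq, @hemp i, neg_zero]; rfl
      · exact ha i j hjp hjq
  generalize #{i | M i p = 0} = s at *
  generalize #{i | M i p ≠ 0} = t at *
  obtain ⟨s, rfl⟩ := Nat.exists_eq_add_of_le' h1
  obtain ⟨t, rfl⟩ := Nat.exists_eq_add_of_le' h2
  have : n - 1 = s + t + 1 := by omega
  rw [this]
  nlinarith [Nat.zero_le (s * t)]

lemma le_gMn_of_const_off_zero_pair [NeZero n] (hn : 8 ≤ n) (M : Matrix (Fin n) (Fin n) ℝ)
    (hM : IsSpecial n M) {q : Fin n} (hq : q ≠ 0) (a : Fin n → ℝ)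
    (ha : ∀ i j, j ≠ q → j ≠ 0 → M i j = a i) :
    2 * (n - 1).factorial ≤ gMn n M := by
  obtain ⟨hne, hcol, hrow, hsum⟩ := hM
  have hMq : ∀ i, M i q = a i - (n - 1) * a i := by
    intro i
    have h := row_sum_of_const_off_pair (M i) hq (a i) (ha i)
    rw [hsum i, hcol i] at h
    linarith
  have hn' : (8 : ℝ) ≤ n := by exact_mod_cast hn
  have ha0 : a 0 = 0 := by
    have h := hMq 0
    rw [hrow] at h
    have : ((n : ℝ) - 2) * a 0 = 0 := by linarith
    rcases mul_eq_zero.mp this with h | h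
    · linarith
    · exact h
  have hdiag : ∀ π : Perm (Fin n), (∑ i, M i (π i) ≠ 0) ↔
      ∑ i, a i ≠ a (π⁻¹ 0) + (n - 1) * a (π⁻¹ q) := by
    intro π
    rw [sum_eq_of_const_off_pair M hq a ha π, hMq, hcol]
    refine not_congr ⟨fun h => by linarith, fun h => by linarith⟩
  rw [gMn_eq_card]
  simp only [hdiag]
  rw [card_perm_inv_rel hq (fun k i => ∑ l, a l ≠ a i + (n - 1) * a k),
    factorial_pred_eq (by omega), ← mul_assoc]
  apply Nat.mul_le_mul_right
  apply two_mul_le_sum_card_ne_affine hn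
  intro w
  by_contra hw
  push Not at hw
  have hz : ∀ i, a i = 0 := fun i => by rw [hw i, ← hw 0, ha0]
  apply hne
  ext i j
  by_cases hj0 : j = 0
  · rw [hj0, hcol]; rfl
  · by_cases hjq : j = q
    · rw [hjq, hMq, hz]; simp
    · rw [ha i j hjq hj0, hz]; rfl

lemma le_gMn_of_const_off_pair [NeZero n] (hn : 8 ≤ n) (M : Matrix (Fin n) (Fin n) ℝ)
    (hM : IsSpecial n M) {p q : Fin n} (hpq : p ≠ q) (a : Fin n → ℝ)
    (ha : ∀ i j, j ≠ p → j ≠ q → M i j = a i) :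
    2 * (n - 1).factorial ≤ gMn n M := by
  by_cases hp : p = 0
  · subst hp
    exact le_gMn_of_const_off_zero_pair hn M hM hpq.symm a fun i j h1 h2 => ha i j h2 h1
  by_cases hq : q = 0
  · subst hq
    exact le_gMn_of_const_off_zero_pair hn M hM hpq a ha
  refine le_gMn_of_zero_off_pair (by omega) M hM hpq fun i j h1 h2 => ?_
  rw [ha i j h1 h2, ← ha i 0 (Ne.symm hp) (Ne.symm hq), hM.2.1]

lemma sum_card_ne_row_le_two_mul [NeZero n] (M : Matrix (Fin n) (Fin n) ℝ)
    (h0 : ∀ j, M 0 j = 0) {b : Fin n} (hb : b ≠ 0) :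
    (∑ j, #{k | j ≠ k ∧ M b j ≠ M b k}) * (n - 2).factorial
      ≤ 2 * #{π : Perm (Fin n) | M b (π 0) ≠ M b (π b) ∧ ∑ i, M i (π i) ≠ 0} := by
  rw [← card_perm_rel hb.symm (fun j k => M b j ≠ M b k), ← filter_filter]
  apply card_le_two_mul_card_filter_ne_zero _ (fun π : Perm (Fin n) => ∑ i, M i (π i)) (swap 0 b)
  · intro π hπ
    simp only [mem_filter, mem_univ, true_and, Perm.mul_apply, swap_apply_left,
      swap_apply_right] at hπ ⊢
    exact hπ.symm
  · intro π hπ e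
    simp only [mem_filter, mem_univ, true_and] at hπ
    rw [sum_mul_swap_zero M h0 b, e, zero_add]
    exact sub_ne_zero.mpr hπ

lemma card_perm_avoiding (hn : 8 ≤ n) {z b c : Fin n} (hb : z ≠ b) (hc : z ≠ c)
    (p q r s : Fin n) :
    (n - 2).factorial ≤ #{π : Perm (Fin n) | π z = r ∧ π b ≠ p ∧ π b ≠ q ∧
      π c ≠ p ∧ π c ≠ q ∧ π c ≠ s} := by
  have hB : ∀ x y : Fin n, z ≠ x →
      #{π : Perm (Fin n) | π z = r ∧ π x = y} ≤ (n - 2).factorial := by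
    intro x y hx
    by_cases hy : r = y
    · have : ({π : Perm (Fin n) | π z = r ∧ π x = y} : Finset _) = ∅ := by
        rw [filter_eq_empty_iff]
        rintro π - ⟨h1, h2⟩
        exact hx (π.injective (by rw [h1, h2, hy]))
      rw [this]
      simp
    · rw [card_perm_apply_pair hx hy]
  have hcov : ({π : Perm (Fin n) | π z = r} : Finset _) ⊆
      ((((({π : Perm (Fin n) | π z = r ∧ π b ≠ p ∧ π b ≠ q ∧ π c ≠ p ∧ π c ≠ q ∧ π c ≠ s} :
        Finset (Perm (Fin n)))
      ∪ ({π : Perm (Fin n) | π z = r ∧ π b = p} : Finset (Perm (Fin n))))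
      ∪ ({π : Perm (Fin n) | π z = r ∧ π b = q} : Finset (Perm (Fin n))))
      ∪ ({π : Perm (Fin n) | π z = r ∧ π c = p} : Finset (Perm (Fin n))))
      ∪ ({π : Perm (Fin n) | π z = r ∧ π c = q} : Finset (Perm (Fin n))))
      ∪ ({π : Perm (Fin n) | π z = r ∧ π c = s} : Finset (Perm (Fin n))) := by
    intro π hπ
    simp only [mem_filter, mem_univ, true_and, mem_union] at hπ ⊢
    tauto
  have h := card_le_card hcov
  rw [card_perm_apply (by omega), factorial_pred_eq (by omega)] at h
  have h1 := h.trans (card_union_le _ _)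
  have h2 := h1.trans (Nat.add_le_add_right (card_union_le _ _) _)
  have h3 := h2.trans (Nat.add_le_add_right (Nat.add_le_add_right (card_union_le _ _) _) _)
  have h4 := h3.trans (Nat.add_le_add_right (Nat.add_le_add_right
    (Nat.add_le_add_right (card_union_le _ _) _) _) _)
  have h5 := h4.trans (Nat.add_le_add_right (Nat.add_le_add_right
    (Nat.add_le_add_right (Nat.add_le_add_right (card_union_le _ _) _) _) _) _)
  have b1 := hB b p hb
  have b2 := hB b q hb
  have b3 := hB c p hc
  have b4 := hB c q hc
  have b5 := hB c s hc
  have h7 : 7 * (n - 2).factorial ≤ (n - 1) * (n - 2).factorial :=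
    Nat.mul_le_mul_right _ (by omega)
  omega

lemma factorial_le_card_of_two_rows [NeZero n] (hn : 8 ≤ n) (M : Matrix (Fin n) (Fin n) ℝ)
    (h0 : ∀ j, M 0 j = 0) {b c : Fin n} (hb : b ≠ 0) (hc : c ≠ 0) (hbc : b ≠ c)
    {p q r s : Fin n} {x y : ℝ} (hbx : ∀ j, j ≠ p → j ≠ q → M b j = x)
    (hcy : ∀ j, j ≠ r → j ≠ s → M c j = y) (hrx : M b r = x) (hry : M c r ≠ y) :
    (n - 2).factorial
      ≤ #{π : Perm (Fin n) | M b (π 0) = M b (π b) ∧ ∑ i, M i (π i) ≠ 0} := by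
  refine (card_perm_avoiding hn hb.symm hc.symm p q r s).trans ?_
  apply card_le_card_of_injOn
    (fun π => if ∑ i, M i (π i) ≠ 0 then π else π * swap 0 c)
  · intro π hπ
    simp only [coe_filter, mem_univ, true_and, Set.mem_ofPred_eq] at hπ ⊢
    obtain ⟨hr, h1, h2, h3, h4, h5⟩ := hπ
    have hcr : π c ≠ r := fun e => hc (π.injective (e.trans hr.symm))
    split_ifs with h
    · exact ⟨by rw [hr, hrx, hbx _ h1 h2], h⟩
    · rw [not_not] at h
      refine ⟨?_, ?_⟩
      · rw [Perm.mul_apply, Perm.mul_apply, swap_apply_left, swap_apply_of_ne_of_ne hb hbc,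
          hbx _ h1 h2, hbx _ h3 h4]
      · rw [sum_mul_swap_zero M h0 c, h, zero_add, hr, hcy _ hcr h5]
        exact sub_ne_zero.mpr hry
  · intro π hπ ρ hρ e
    simp only [coe_filter, mem_univ, true_and, Set.mem_ofPred_eq] at hπ hρ
    have key : ∀ σ τ : Perm (Fin n), σ 0 = r → τ 0 = r → σ ≠ τ * swap 0 c := by
      intro σ τ hσ hτ e'
      have : τ c = r := by rw [← hσ, e']; simp
      exact hc (τ.injective (this.trans hτ.symm))
    simp only at e
    split_ifs at e
    · exact e
    · exact absurd e (key _ _ hπ.1 hρ.1)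
    · exact absurd e.symm (key _ _ hρ.1 hπ.1)
    · exact mul_right_cancel e

end DiagonalSums

/-- Theorem 1, bound: for n ≥ 8 or n = 3 and any special n×n matrix M,
g_M(n) ≥ 2(n−1)!. -/
theorem statement10 (n : ℕ) [NeZero n] (hn : 8 ≤ n ∨ n = 3)
    (M : Matrix (Fin n) (Fin n) ℝ) (hM : IsSpecial n M) :
    2 * Nat.factorial (n - 1) ≤ gMn n M := by
  obtain hn | rfl := hn
  · have hM' := hM
    obtain ⟨hne, hcol, hrow, hsum⟩ := hM'
    have hex : ∃ b j, M b j ≠ 0 := by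
      by_contra h
      push Not at h
      exact hne (by ext i j; exact h i j)
    by_cases hbig : ∃ b, b ≠ 0 ∧ ∀ w, 3 ≤ #{j | M b j ≠ w}
    · obtain ⟨b, hb, h3⟩ := hbig
      have h1 := sum_card_ne_row_le_two_mul M hrow hb
      have h2 := Nat.mul_le_mul_right (n - 2).factorial (sum_card_ne_of_three_le hn (M b) h3)
      have h4 : #{π : Perm (Fin n) | M b (π 0) ≠ M b (π b) ∧ ∑ i, M i (π i) ≠ 0} ≤ gMn n M := by
        rw [gMn_eq_card, ← filter_filter, filter_comm]
        exact card_filter_le _ _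
      rw [factorial_pred_eq (by omega)]
      rw [mul_assoc] at h2
      omega
    · push Not at hbig
      have hrows : ∀ b, (∃ j, M b j ≠ 0) → ∃ w p q, p ≠ q ∧ M b p ≠ w ∧ M b q ≠ w ∧
          M b p ≠ M b q ∧ ∀ j, j ≠ p → j ≠ q → M b j = w := by
        intro b hbj
        have hb : b ≠ 0 := by
          rintro rfl
          obtain ⟨j, hj⟩ := hbj
          exact hj (hrow j)
        obtain ⟨w, hw⟩ := hbig b hb
        exact ⟨w, exists_pair_of_card_ne_le_two (by omega) (M b) (hcol b) (hsum b) hbj w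
          (by omega)⟩
      obtain ⟨b, hbj⟩ := hex
      obtain ⟨x, p, q, hpq, hp, hq, hMpq, hx⟩ := hrows b hbj
      have hb : b ≠ 0 := by
        rintro rfl
        obtain ⟨j, hj⟩ := hbj
        exact hj (hrow j)
      by_cases hshare : ∀ c, ∃ y, ∀ j, j ≠ p → j ≠ q → M c j = y
      · choose a ha using hshare
        exact le_gMn_of_const_off_pair hn M hM hpq a ha
      · push Not at hshare
        obtain ⟨c, hc⟩ := hshare
        have hcj : ∃ j, M c j ≠ 0 := by
          obtain ⟨j, -, -, hj⟩ := hc 0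
          exact ⟨j, hj⟩
        have hc0 : c ≠ 0 := by
          rintro rfl
          obtain ⟨j, hj⟩ := hcj
          exact hj (hrow j)
        obtain ⟨y, r, s, -, -, -, -, hy⟩ := hrows c hcj
        obtain ⟨t, htp, htq, hty⟩ := hc y
        have hbc : b ≠ c := by
          rintro rfl
          obtain ⟨j, h1, h2, h3⟩ := hc x
          exact h3 (hx j h1 h2)
        have hextra : (n - 2).factorial
            ≤ #{π : Perm (Fin n) | M b (π 0) = M b (π b) ∧ ∑ i, M i (π i) ≠ 0} := by
          by_cases htr : t = r
          · subst htr
            exact factorial_le_card_of_two_rows hn M hrow hb hc0 hbc hx hy (hx t htp htq) hty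
          · have hts : t = s := by
              by_contra hts
              exact hty (hy t htr hts)
            subst hts
            exact factorial_le_card_of_two_rows hn M hrow hb hc0 hbc hx
              (fun j h1 h2 => hy j h2 h1) (hx t htp htq) hty
        have h1 := sum_card_ne_row_le_two_mul M hrow hb
        have h2 := Nat.mul_le_mul_right (n - 2).factorial
          (sum_card_ne_of_pair (by omega) (M b) x hpq hp hq hMpq hx)
        have h4 : #{π : Perm (Fin n) | M b (π 0) = M b (π b) ∧ ∑ i, M i (π i) ≠ 0}
            + #{π : Perm (Fin n) | M b (π 0) ≠ M b (π b) ∧ ∑ i, M i (π i) ≠ 0}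
            = gMn n M := by
          rw [gMn_eq_card, ← card_filter_add_card_filter_not
            (s := {π : Perm (Fin n) | ∑ i, M i (π i) ≠ 0}) (fun π => M b (π 0) = M b (π b)),
            filter_filter, filter_filter]
          simp only [and_comm, ne_eq]
        rw [factorial_pred_eq (by omega)]
        have h5 : 4 * n - 6 + 2 = 4 * (n - 1) := by omega
        have h6 : (4 * n - 6) * (n - 2).factorial + 2 * (n - 2).factorial
            = 4 * ((n - 1) * (n - 2).factorial) := by
          rw [← add_mul, h5, mul_assoc]
        omega
  · refine le_gMn_of_zero_off_pair (by omega) M hM (p := 1) (q := 2) (by simp) ?_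
    intro i j h1 h2
    have hj : j = 0 := by
      fin_cases j <;> simp_all
    rw [hj, hM.2.1]
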